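/- Every topological space X is β-submaximal: every β-dense subset of X is β-open. -/

import Mathlib

open Set

/-- A set is β-open if it is contained in the closure of the interior of its closure. -/
def IsBetaOpen {X : Type*} [TopologicalSpace X] (S : Set X) : Prop :=
  S ⊆ closure (interior (closure S))

/-- A set is β-closed if its complement is β-open. -/
def IsBetaClosed {X : Type*} [TopologicalSpace X] (S : Set X) : Prop :=
  IsBetaOpen Sᶜ

/-- The β-closure of a set: the intersection of all β-closed supersets. -/
def betaClosure {X : Type*} [TopologicalSpace X] (S : Set X) : Set X :=
  ⋂₀ {F : Set X | IsBetaClosed F ∧ S ⊆ F}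

theorem IsOpen.isBetaOpen {X : Type*} [TopologicalSpace X] {S : Set X} (hS : IsOpen S) :
    IsBetaOpen S :=
  (hS.subset_interior_iff.mpr subset_closure).trans subset_closure

theorem betaClosure_subset_closure {X : Type*} [TopologicalSpace X] (S : Set X) :
    betaClosure S ⊆ closure S :=
  sInter_subset_of_mem ⟨isClosed_closure.isOpen_compl.isBetaOpen, subset_closure⟩

theorem every_space_betaSubmaximal {X : Type*} [TopologicalSpace X] :
    ∀ A : Set X, betaClosure A = univ → IsBetaOpen A := by
  intro A hA
  have hdense : closure A = univ := univ_subset_iff.mp (hA ▸ betaClosure_subset_closure A)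
  simp [IsBetaOpen, hdense]
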